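/- arXiv:1509.05396 — 6 statements merged into one kernel-verified Lean document; each statement's English description precedes it below -/
import Mathlib

section
/- If a word x over the alphabet {0,1} is a palindrome pair, then every conjugate of x is also a palindrome pair. -/
/-- A word over {0,1} (represented as `List Bool`) is a *palindrome pair*
if it is a concatenation of two palindromes. -/
def PalPair (w : List Bool) : Prop :=
  ∃ p q : List Bool, p.Palindrome ∧ q.Palindrome ∧ w = p ++ q

theorem PalPair.concat_of_cons {a : Bool} {w : List Bool} (h : PalPair (a :: w)) :
    PalPair (w ++ [a]) := by
  obtain ⟨p, q, hp, hq, e⟩ := h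
  wlog hne : p ≠ [] generalizing p q
  · obtain rfl : p = [] := not_not.mp hne
    refine this q [] hq .nil (by simpa using e) ?_
    rintro rfl
    simp at e
  cases hp with
  | nil => exact absurd rfl hne
  | singleton b =>
    obtain ⟨rfl, rfl⟩ : a = b ∧ w = q := by simpa using e
    exact ⟨w, [a], hq, .singleton a, rfl⟩
  | @cons_concat b r hr =>
    obtain ⟨rfl, rfl⟩ : a = b ∧ w = r ++ a :: q := by
      simp only [List.cons_append, List.append_assoc, List.nil_append, List.cons.injEq] at e
      exact ⟨e.1, e.1 ▸ e.2⟩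
    exact ⟨r, a :: (q ++ [a]), hr, .cons_concat a hq, by simp⟩

/-- Any conjugate of a palindrome pair is a palindrome pair. -/
theorem conjugate_of_palPair (x : List Bool) (hx : PalPair x)
    (u v : List Bool) (h : x = u ++ v) : PalPair (v ++ u) := by
  subst h
  induction u generalizing v with
  | nil => simpa using hx
  | cons a u ih =>
    have := ih (v ++ [a]) (by simpa using PalPair.concat_of_cons hx)
    simpa using this
end

section
/- For every n ≥ 2 and every k with 1 ≤ k ≤ a_{n-1}, the word s_{n-1}^k s_{n-2} is a palindrome pair. -/
/-- `wpow w k` is the `k`-fold concatenation `w^k`. -/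
def wpow (w : List Bool) (k : ℕ) : List Bool := (List.replicate k w).flatten

/-- The standard words: `s 0 = 1`, `s 1 = 0`, `s n = s (n-1) ^ (a (n-1)) ++ s (n-2)`
(here `false` plays the role of the letter 0 and `true` that of the letter 1). -/
def stdWord (a : ℕ → ℕ) : ℕ → List Bool
  | 0 => [true]
  | 1 => [false]
  | (n+2) => wpow (stdWord a (n+1)) (a (n+1)) ++ stdWord a n

theorem palPair_of_append_eq_append_reverse (w c : List Bool)
    (h : w ++ c = c ++ w.reverse) : PalPair w := by
  rcases List.append_eq_append_iff.1 h with ⟨d, hd, hd'⟩ | ⟨t, ht, ht'⟩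
  · by_cases hw : w = []
    · exact ⟨[], [], .nil, .nil, hw⟩
    · have hlen : d.length < c.length := by
        have := List.length_pos_of_ne_nil hw
        rw [hd, List.length_append]
        omega
      exact palPair_of_append_eq_append_reverse w d (hd.symm.trans hd')
  · have h2 : t.reverse ++ c.reverse = t ++ c := by
      rw [← ht', ht, List.reverse_append]
    obtain ⟨h3, h4⟩ := List.append_inj h2 (List.length_reverse ..)
    exact ⟨c, t, .of_reverse_eq h4, .of_reverse_eq h3, ht⟩
termination_by c.length

theorem wpow_succ (x : List Bool) (k : ℕ) : wpow x (k + 1) = x ++ wpow x k := by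
  simp [wpow, List.replicate_succ]

theorem append_wpow_comm (x : List Bool) (k : ℕ) : x ++ wpow x k = wpow x k ++ x := by
  induction k with
  | zero => simp [wpow]
  | succ k ih => rw [wpow_succ, List.append_assoc, ← ih]

theorem wpow_append_of_append_eq {x c : List Bool} (h : x ++ c = c ++ x.reverse) (k : ℕ) :
    wpow x k ++ c = c ++ (wpow x k).reverse := by
  induction k with
  | zero => simp [wpow]
  | succ k ih =>
    conv_rhs => rw [wpow_succ, append_wpow_comm, List.reverse_append, ← List.append_assoc, ← h]
    rw [wpow_succ, List.append_assoc, ih, List.append_assoc]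

theorem wpow_append_append_eq {x y c : List Bool} (hx : x ++ c = c ++ x.reverse)
    (hy : y ++ c = c ++ y.reverse) (k : ℕ) :
    (wpow x k ++ y) ++ (wpow x k ++ c) = (wpow x k ++ c) ++ (wpow x k ++ y).reverse := by
  rw [wpow_append_of_append_eq hx, List.reverse_append, ← wpow_append_of_append_eq hx]
  simp only [List.append_assoc]
  rw [wpow_append_of_append_eq hx, ← List.append_assoc y, hy, List.append_assoc]

/-- Two consecutive standard words are conjugated to their reversals by a common word. -/
theorem exists_stdWord_append_eq (a : ℕ → ℕ) (n : ℕ) :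
    ∃ c, stdWord a (n + 1) ++ c = c ++ (stdWord a (n + 1)).reverse ∧
      stdWord a n ++ c = c ++ (stdWord a n).reverse := by
  induction n with
  | zero => exact ⟨[], by simp [stdWord]⟩
  | succ n ih =>
    obtain ⟨c, hx, hy⟩ := ih
    refine ⟨wpow (stdWord a (n + 1)) (a (n + 1)) ++ c, wpow_append_append_eq hx hy _, ?_⟩
    rw [← List.append_assoc, append_wpow_comm, List.append_assoc, hx, List.append_assoc]

/-- For `n ≥ 2` and `1 ≤ k ≤ a (n-1)`, the word `s (n-1) ^ k ++ s (n-2)`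
is a palindrome pair. -/
theorem stdWord_pow_palPair (a : ℕ → ℕ) (ha : ∀ n, 2 ≤ n → 1 ≤ a n)
    (n : ℕ) (hn : 2 ≤ n) (k : ℕ) (hk1 : 1 ≤ k) (hk2 : k ≤ a (n - 1)) :
    PalPair (wpow (stdWord a (n - 1)) k ++ stdWord a (n - 2)) := by
  obtain ⟨m, rfl⟩ := Nat.exists_eq_add_of_le' hn
  obtain ⟨c, hx, hy⟩ := exists_stdWord_append_eq a m
  exact palPair_of_append_eq_append_reverse _ _ (wpow_append_append_eq hx hy k)
end

section
/- For each i ≥ 1 and each j ≥ i, every factor of p_j of length |p_i| + 1 is a palindrome pair. (Consequently, every factor of the limiting infinite word p of length |p_i| + 1 is a palindrome pair.) -/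
/-- Given a sequence of palindromes `w 0, w 1, ...`, the sequence of words
`p` with `p 0 = 0` and
`p (i+1) = p i ⬝ (w i).1 ⬝ p i ⬝ (w i).2 ⬝ ⋯ ⬝ p i ⬝ (w i).last ⬝ p i`
(letters of `w i` shuffled between copies of `p i`).  Here `pseq w i`
corresponds to `p_{i+1}` of the paper and `w i` to `w_{i+1}`, and `false`
plays the role of the letter 0. -/
def pseq (w : ℕ → List Bool) : ℕ → List Bool
  | 0 => [false]
  | (i+1) => (w i).foldr (fun b acc => pseq w i ++ b :: acc) (pseq w i)

/-- The word `P b₁ P b₂ ⋯ P bₙ P` obtained by placing the letters of `l` between copies of `P`. -/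
def interleave (P l : List Bool) : List Bool :=
  l.foldr (fun b acc => P ++ b :: acc) P

theorem interleave_cons (P : List Bool) (b : Bool) (l : List Bool) :
    interleave P (b :: l) = P ++ b :: interleave P l := rfl

theorem interleave_append_cons (P l : List Bool) (b : Bool) (l' : List Bool) :
    interleave P (l ++ b :: l') = interleave P l ++ b :: interleave P l' := by
  induction l with
  | nil => rfl
  | cons c l ih => simp [interleave_cons, ih]

theorem interleave_interleave (P m l : List Bool) :
    ∃ k, interleave (interleave P m) l = interleave P k := by
  induction l with
  | nil => exact ⟨m, rfl⟩
  | cons b l ih =>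
    obtain ⟨k, hk⟩ := ih
    exact ⟨m ++ b :: k, by rw [interleave_append_cons, interleave_cons, hk]⟩

theorem reverse_interleave {P : List Bool} (hP : P.reverse = P) (l : List Bool) :
    (interleave P l).reverse = interleave P l.reverse := by
  induction l with
  | nil => exact hP
  | cons b l ih =>
    rw [interleave_cons, List.reverse_cons, interleave_append_cons, ← ih]
    simp [hP, interleave]

theorem prefix_interleave (P l : List Bool) : P <+: interleave P l := by
  cases l with
  | nil => exact List.prefix_rfl
  | cons b l => exact List.prefix_append _ _

theorem pseq_succ (w : ℕ → List Bool) (i : ℕ) :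
    pseq w (i + 1) = interleave (pseq w i) (w i) := rfl

theorem reverse_pseq {w : ℕ → List Bool} (hw : ∀ i, (w i).Palindrome) (i : ℕ) :
    (pseq w i).reverse = pseq w i := by
  induction i with
  | zero => rfl
  | succ i ih => rw [pseq_succ, reverse_interleave ih, (hw i).reverse_eq]

theorem exists_pseq_eq_interleave (w : ℕ → List Bool) {i j : ℕ} (hij : i ≤ j) :
    ∃ l, pseq w j = interleave (pseq w i) l := by
  induction j, hij using Nat.le_induction with
  | base => exact ⟨[], rfl⟩
  | succ j _ ih =>
    obtain ⟨m, hm⟩ := ih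
    rw [pseq_succ, hm]
    exact interleave_interleave _ _ _

/-- If `t ++ s` is a palindrome, then `s ++ b :: t` is a palindrome pair. -/
theorem palPair_append_cons {s t : List Bool} (b : Bool)
    (h : (t ++ s).reverse = t ++ s) : PalPair (s ++ b :: t) := by
  rw [List.reverse_append] at h
  rcases List.append_eq_append_iff.1 h with ⟨m, rfl, hm⟩ | ⟨m, hs, rfl⟩
  · have hmr : m.reverse = m := by simpa using hm
    exact ⟨s ++ b :: s.reverse, m, .of_reverse_eq (by simp), .of_reverse_eq hmr, by simp⟩
  · have hmr : m.reverse = m := by simpa using hs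
    exact ⟨m, t.reverse ++ b :: t, .of_reverse_eq hmr, .of_reverse_eq (by simp), by simp⟩

theorem palPair_of_infix_interleave {P : List Bool} (hP : P.reverse = P) {l u : List Bool}
    (hu : u <:+: interleave P l) (hlen : u.length = P.length + 1) : PalPair u := by
  induction l with
  | nil =>
    have := hu.length_le
    simp only [interleave, List.foldr_nil] at this
    omega
  | cons b l ih =>
    obtain ⟨A, B, h⟩ := hu
    rw [interleave_cons, List.append_assoc] at h
    rcases List.append_eq_append_iff.1 h with ⟨s, hPs, hs⟩ | ⟨c, rfl, hc⟩
    · rcases List.append_eq_append_iff.1 hs with ⟨c, rfl, -⟩ | ⟨c, rfl, hc⟩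
      · have := congrArg List.length hPs
        simp only [List.length_append] at this hlen
        omega
      · cases c with
        | nil =>
          have := congrArg List.length hPs
          simp only [List.length_append, List.length_nil] at this hlen
          omega
        | cons c t =>
          simp only [List.cons_append, List.cons.injEq] at hc
          obtain ⟨rfl, hc⟩ := hc
          have hl := congrArg List.length hPs
          simp only [List.length_append, List.length_cons] at hl hlen
          have ht : t <+: P :=
            List.prefix_of_prefix_length_le ⟨B, hc.symm⟩ (prefix_interleave P l) (by omega)
          obtain ⟨r, hr⟩ := ht
          have hrs : r = s := by
            refine (List.append_inj' (hr.trans hPs) ?_).2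
            have := congrArg List.length hr
            simp only [List.length_append] at this
            omega
          subst hrs
          exact palPair_append_cons _ (by rw [hr, hP])
    · cases c with
      | nil =>
        rw [List.nil_append] at hc
        cases u with
        | nil => simp at hlen
        | cons d t =>
          simp only [List.cons_append, List.cons.injEq] at hc
          obtain ⟨rfl, hc⟩ := hc
          have ht : t = P := by
            have ht' : t <+: P :=
              List.prefix_of_prefix_length_le ⟨B, hc.symm⟩ (prefix_interleave P l)
                (by simpa using hlen.le)
            exact ht'.eq_of_length (by simpa using hlen)
          exact palPair_append_cons (s := []) _ (by simp [ht, hP])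
      | cons d c =>
        simp only [List.cons_append, List.cons.injEq] at hc
        exact ih ⟨c, B, by rw [List.append_assoc, hc.2]⟩

/-- For all `i ≤ j`, every factor of `p j` of length `|p i| + 1` is a
palindrome pair.  (Since every factor of the limiting word `p` is a factor of
some `p j`, every factor of `p` of length `|p i| + 1` is a palindrome pair.) -/
theorem pseq_factors_palPair (w : ℕ → List Bool)
    (hw : ∀ i, (w i).Palindrome ∧ w i ≠ [])
    (i j : ℕ) (hij : i ≤ j)
    (u : List Bool) (hu : u <:+: pseq w j)
    (hlen : u.length = (pseq w i).length + 1) :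
    PalPair u := by
  obtain ⟨l, hl⟩ := exists_pseq_eq_interleave w hij
  rw [hl] at hu
  exact palPair_of_infix_interleave (reverse_pseq (fun k => (hw k).1) i) hu hlen
end

section
/- For every n ≥ 6 there exists a factor of the Thue–Morse word t of length n that is not a palindrome pair; hence there are only finitely many n for which every length-n factor of t is a palindrome pair (t does not have property PP). -/
/-- The Thue–Morse morphism `μ` with `μ(0) = 01` and `μ(1) = 10`
(`false` plays the role of 0 and `true` that of 1). -/
def mu (w : List Bool) : List Bool :=
  (w.map (fun b => if b then [true, false] else [false, true])).flatten

/-- A finite word is a factor of the Thue–Morse word `t = μ^ω(0)` iff it is a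
factor of `μ^k(0)` for some `k`. -/
def FactorTM (w : List Bool) : Prop :=
  ∃ k, w <:+: mu^[k] [false]

/-- The letter of the Thue–Morse word at position `n`. -/
def thueMorse (n : ℕ) : Bool :=
  Nat.binaryRec false (fun b _ r => xor b r) n

/-- The factor of the Thue–Morse word of length `l` starting at `s` is a palindrome. -/
def PalAt (s l : ℕ) : Prop :=
  ∀ i < l, thueMorse (s + i) = thueMorse (s + (l - 1 - i))

/-- The factor of the Thue–Morse word of length `n` starting at `s` is a palindrome pair. -/
def PalPairAt (s n : ℕ) : Prop :=
  ∃ l ≤ n, PalAt s l ∧ PalAt (s + l) (n - l)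

instance (s l : ℕ) : Decidable (PalAt s l) := by
  unfold PalAt; infer_instance

instance (s n : ℕ) : Decidable (PalPairAt s n) :=
  decidable_of_iff (∃ l < n + 1, PalAt s l ∧ PalAt (s + l) (n - l)) <| by
    simp only [PalPairAt, Nat.lt_succ_iff]

theorem thueMorse_two_mul (n : ℕ) : thueMorse (2 * n) = thueMorse n := by
  simpa [thueMorse, Nat.bit] using
    Nat.binaryRec_eq (motive := fun _ => Bool) (bit := fun b _ r => xor b r) (zero := false)
      false n (Or.inl rfl)

theorem thueMorse_two_mul_add_one (n : ℕ) : thueMorse (2 * n + 1) = !thueMorse n := by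
  simpa [thueMorse, Nat.bit] using
    Nat.binaryRec_eq (motive := fun _ => Bool) (bit := fun b _ r => xor b r) (zero := false)
      true n (Or.inl rfl)

theorem thueMorse_cube_free (k : ℕ) :
    ¬ (thueMorse k = thueMorse (k + 1) ∧ thueMorse (k + 1) = thueMorse (k + 2)) := by
  rintro ⟨h₁, h₂⟩
  obtain ⟨m, rfl | rfl⟩ := Nat.even_or_odd' k
  · rw [thueMorse_two_mul, thueMorse_two_mul_add_one] at h₁
    simp at h₁
  · rw [show 2 * m + 1 + 1 = 2 * (m + 1) by ring, show 2 * m + 1 + 2 = 2 * (m + 1) + 1 by ring,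
      thueMorse_two_mul, thueMorse_two_mul_add_one] at h₂
    simp at h₂

theorem not_palAt_five (s : ℕ) :
    ¬ (thueMorse s = thueMorse (s + 4) ∧ thueMorse (s + 1) = thueMorse (s + 3)) := by
  rintro ⟨h₁, h₂⟩
  obtain ⟨m, rfl | rfl⟩ := Nat.even_or_odd' s
  · have := thueMorse_cube_free m
    rw [show 2 * m + 3 = 2 * (m + 1) + 1 by ring, thueMorse_two_mul_add_one,
      thueMorse_two_mul_add_one] at h₂
    rw [show 2 * m + 4 = 2 * (m + 2) by ring, thueMorse_two_mul, thueMorse_two_mul] at h₁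
    simp_all
  · have := thueMorse_cube_free m
    rw [show 2 * m + 1 + 1 = 2 * (m + 1) by ring, show 2 * m + 1 + 3 = 2 * (m + 2) by ring,
      thueMorse_two_mul, thueMorse_two_mul] at h₂
    rw [show 2 * m + 1 + 4 = 2 * (m + 2) + 1 by ring, thueMorse_two_mul_add_one,
      thueMorse_two_mul_add_one] at h₁
    simp_all

theorem PalAt.sub_two {s l : ℕ} (h : PalAt s (l + 2)) : PalAt (s + 1) l := by
  intro i hi
  have := h (i + 1) (by omega)
  rw [show s + (i + 1) = s + 1 + i by ring,
    show s + (l + 2 - 1 - (i + 1)) = s + 1 + (l - 1 - i) by omega] at this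
  exact this

theorem PalAt.center {s l m : ℕ} (h : PalAt s (l + 2 * m)) : PalAt (s + m) l := by
  induction m generalizing s with
  | zero => exact h
  | succ m ih =>
    rw [show s + (m + 1) = s + 1 + m by ring]
    exact ih h.sub_two

/-- Odd palindromes in the Thue–Morse word have length at most `3`. -/
theorem PalAt.le_three_of_odd {s m : ℕ} (h : PalAt s (2 * m + 1)) : m ≤ 1 := by
  by_contra! hm
  obtain ⟨k, rfl⟩ := Nat.exists_eq_add_of_le hm
  rw [show 2 * (1 + 1 + k) + 1 = 5 + 2 * k by ring] at h
  have h5 := h.center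
  exact not_palAt_five _ ⟨h5 0 (by omega), h5 1 (by omega)⟩

/-- Nonempty even palindromes are centred at even positions. -/
theorem PalAt.even_center {s r : ℕ} (h : PalAt s (2 * r)) (hr : 1 ≤ r) : 2 ∣ s + r := by
  obtain ⟨k, rfl⟩ := Nat.exists_eq_add_of_le hr
  rw [show 2 * (1 + k) = 2 + 2 * k by ring] at h
  have h2 := h.center 0 (by omega)
  by_contra hodd
  obtain ⟨j, hj⟩ : ∃ j, s + k = 2 * j := ⟨(s + k) / 2, by omega⟩
  simp [hj, thueMorse_two_mul, thueMorse_two_mul_add_one] at h2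

/-- Even palindromes of length at least `14` are centred at multiples of `4`. -/
theorem PalAt.four_dvd_center {s r : ℕ} (h : PalAt s (2 * r)) (hr : 7 ≤ r) : 4 ∣ s + r := by
  have heven := h.even_center (by omega)
  obtain ⟨k, rfl⟩ := Nat.exists_eq_add_of_le hr
  by_contra hdvd
  rw [show 2 * (7 + k) = 14 + 2 * k by ring] at h
  have h14 := h.center
  obtain ⟨j, hj⟩ : ∃ j, s + k = 4 * j + 3 := ⟨(s + k) / 4, by omega⟩
  rw [hj] at h14
  have e₁ := h14 0 (by omega)
  have e₂ := h14 4 (by omega)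
  norm_num at e₁ e₂
  rw [show 4 * j + 3 = 2 * (2 * j + 1) + 1 by ring,
    show 2 * (2 * j + 1) + 1 + 13 = 2 * (2 * (j + 4)) by ring] at e₁
  rw [show 4 * j + 3 + 4 = 2 * (2 * (j + 1) + 1) + 1 by ring,
    show 4 * j + 3 + 9 = 2 * (2 * (j + 3)) by ring] at e₂
  simp only [thueMorse_two_mul, thueMorse_two_mul_add_one, Bool.not_not] at e₁ e₂
  exact not_palAt_five j ⟨e₁, e₂⟩

/-- Long palindromes have even length and are centred at multiples of `4`. -/
theorem PalAt.long {s l : ℕ} (h : PalAt s l) (hl : 12 < l) : 2 ∣ l ∧ 4 ∣ s + l / 2 := by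
  obtain ⟨r, rfl | rfl⟩ := Nat.even_or_odd' l
  · have := h.four_dvd_center (by omega)
    omega
  · have := h.le_three_of_odd
    omega

theorem thueMorse_four_mul (n : ℕ) : thueMorse (4 * n) = thueMorse n := by
  rw [show 4 * n = 2 * (2 * n) by ring, thueMorse_two_mul, thueMorse_two_mul]

theorem thueMorse_four_mul_add_three (n : ℕ) : thueMorse (4 * n + 3) = thueMorse n := by
  rw [show 4 * n + 3 = 2 * (2 * n + 1) + 1 by ring, thueMorse_two_mul_add_one,
    thueMorse_two_mul_add_one, Bool.not_not]

/-- A palindrome aligned with the images of letters under `μ²` desubstitutes. -/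
theorem PalAt.of_four_mul {s l : ℕ} (h : PalAt (4 * s) (4 * l)) : PalAt s l := by
  intro i hi
  have := h (4 * i) (by omega)
  rw [show 4 * s + 4 * i = 4 * (s + i) by ring,
    show 4 * s + (4 * l - 1 - 4 * i) = 4 * (s + (l - 1 - i)) + 3 by omega,
    thueMorse_four_mul, thueMorse_four_mul_add_three] at this
  exact this

theorem PalAt.sixteen_dvd_center {s l : ℕ} (h : PalAt s l) (hl : 52 ≤ l) :
    2 ∣ l ∧ 16 ∣ s + l / 2 := by
  obtain ⟨h2, h4⟩ := h.long (by omega)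
  obtain ⟨e, he⟩ := h4
  refine ⟨h2, ?_⟩
  -- the central palindrome is desubstituted letter by letter around its centre
  have hpal : PalAt (e - 7) (2 * 7) := by
    have key : ∀ j < 7, thueMorse (e + j) = thueMorse (e - 1 - j) := by
      intro j hj
      have := h (l / 2 + 4 * j) (by omega)
      rw [show s + (l / 2 + 4 * j) = 4 * (e + j) by omega,
        show s + (l - 1 - (l / 2 + 4 * j)) = 4 * (e - 1 - j) + 3 by omega,
        thueMorse_four_mul, thueMorse_four_mul_add_three] at this
      exact this
    intro i hi
    rcases lt_or_ge i 7 with h7 | h7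
    · have := key (6 - i) (by omega)
      rw [show e - 7 + i = e - 1 - (6 - i) by omega,
        show e - 7 + (2 * 7 - 1 - i) = e + (6 - i) by omega]
      exact this.symm
    · have := key (i - 7) (by omega)
      rw [show e - 7 + i = e + (i - 7) by omega,
        show e - 7 + (2 * 7 - 1 - i) = e - 1 - (i - 7) by omega]
      exact this
  have := hpal.four_dvd_center le_rfl
  omega

theorem PalPairAt.of_four_mul {s m : ℕ} (hm : 2 ∣ m) (hm8 : 8 ≤ m)
    (h : PalPairAt (4 * s) (4 * m)) : PalPairAt s m := by
  obtain ⟨l, hl, hp, hq⟩ := h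
  have hdvd : 4 ∣ l := by
    rcases lt_or_ge 12 l with h12 | h12
    · have := hp.long h12
      omega
    · have := hq.long (by omega)
      omega
  obtain ⟨k, rfl⟩ := hdvd
  refine ⟨k, by omega, hp.of_four_mul, ?_⟩
  rw [← mul_add, ← Nat.mul_sub] at hq
  exact hq.of_four_mul

theorem exists_not_palPairAt_of_not_dvd {n : ℕ} (hn : 64 ≤ n) (h8 : ¬ 8 ∣ n) :
    ∃ s, ¬ PalPairAt s n := by
  obtain ⟨s, hs⟩ : ∃ s, (s + n / 2) % 16 = 8 := ⟨24 - n / 2 % 16, by omega⟩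
  refine ⟨s, ?_⟩
  rintro ⟨l, hl, hp, hq⟩
  rcases lt_or_ge 12 l with h₁ | h₁
  · rcases lt_or_ge 12 (n - l) with h₂ | h₂
    · have := hp.long h₁
      have := hq.long h₂
      omega
    · have := hp.sixteen_dvd_center (by omega)
      omega
  · have := hq.sixteen_dvd_center (by omega)
    omega

theorem exists_not_palPairAt_of_lt :
    ∀ n < 64, 6 ≤ n → ∃ s < 64, ¬ PalPairAt s n := by
  decide +kernel

theorem exists_not_palPairAt (n : ℕ) (hn : 6 ≤ n) : ∃ s, ¬ PalPairAt s n := by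
  induction n using Nat.strong_induction_on with
  | _ n ih =>
    rcases lt_or_ge n 64 with h | h
    · obtain ⟨s, -, hs⟩ := exists_not_palPairAt_of_lt n h hn
      exact ⟨s, hs⟩
    · by_cases h8 : 8 ∣ n
      · obtain ⟨k, rfl⟩ := h8
        obtain ⟨s, hs⟩ := ih (2 * k) (by omega) (by omega)
        refine ⟨4 * s, fun hpp => hs (PalPairAt.of_four_mul (by omega) (by omega) ?_)⟩
        rwa [show 4 * (2 * k) = 8 * k by ring]
      · exact exists_not_palPairAt_of_not_dvd h h8

theorem mu_map_range (n : ℕ) :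
    mu ((List.range n).map thueMorse) = (List.range (2 * n)).map thueMorse := by
  induction n with
  | zero => rfl
  | succ n ih =>
    have happ : ∀ a b, mu (a ++ b) = mu a ++ mu b := by simp [mu]
    rw [show 2 * (n + 1) = 2 * n + 1 + 1 by ring, List.range_succ, List.range_succ,
      List.range_succ, List.map_append, happ, ih]
    cases h : thueMorse n <;> simp [mu, h, thueMorse_two_mul, thueMorse_two_mul_add_one]

theorem mu_iterate (k : ℕ) : mu^[k] [false] = (List.range (2 ^ k)).map thueMorse := by
  induction k with
  | zero => simp [thueMorse]
  | succ k ih => rw [Function.iterate_succ_apply', ih, mu_map_range, pow_succ']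

/-- The factor of the Thue–Morse word of length `n` starting at `s`. -/
def factorAt (s n : ℕ) : List Bool :=
  (List.range n).map fun i => thueMorse (s + i)

theorem factorTM_factorAt (s n : ℕ) : FactorTM (factorAt s n) := by
  refine ⟨s + n, (List.range s).map thueMorse,
    (List.range (2 ^ (s + n) - (s + n))).map fun i => thueMorse (s + n + i), ?_⟩
  have hle : s + n ≤ 2 ^ (s + n) := Nat.lt_two_pow_self.le
  rw [mu_iterate]
  conv_rhs => rw [← Nat.add_sub_cancel' hle]
  simp only [factorAt, List.range_add, List.map_append, List.map_map, Function.comp_def]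

theorem PalPair.palPairAt {s n : ℕ} (h : PalPair (factorAt s n)) : PalPairAt s n := by
  obtain ⟨p, q, hp, hq, hw⟩ := h
  have hlen : n = p.length + q.length := by
    simpa [factorAt] using congrArg List.length hw
  have hget : ∀ i < n, (p ++ q)[i]? = some (thueMorse (s + i)) := by
    intro i hi
    rw [← hw]
    simp [factorAt, hi]
  have hpget : ∀ i < p.length, p[i]? = some (thueMorse (s + i)) := by
    intro i hi
    rw [← hget i (by omega), List.getElem?_append_left hi]
  have hqget : ∀ i < q.length, q[i]? = some (thueMorse (s + p.length + i)) := by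
    intro i hi
    rw [add_assoc, ← hget _ (by omega), List.getElem?_append_right (by omega),
      Nat.add_sub_cancel_left]
  have aux : ∀ (w : List Bool) (a : ℕ), w.Palindrome →
      (∀ i < w.length, w[i]? = some (thueMorse (a + i))) → PalAt a w.length := by
    intro w a hw hwget i hi
    have h₁ := hwget i hi
    rw [← hw.reverse_eq, List.getElem?_reverse hi, hwget _ (by omega)] at h₁
    exact (Option.some.inj h₁).symm
  refine ⟨p.length, by omega, aux p s hp hpget, ?_⟩
  rw [hlen, Nat.add_sub_cancel_left]
  exact aux q _ hq hqget

/-- For every `n ≥ 6` the Thue–Morse word has a factor of length `n` that is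
not a palindrome pair; hence there are only finitely many `n` such that every
length-`n` factor of the Thue–Morse word is a palindrome pair (the Thue–Morse
word does not have property PP). -/
theorem thueMorse_not_PP :
    (∀ n, 6 ≤ n → ∃ u : List Bool, FactorTM u ∧ u.length = n ∧ ¬ PalPair u) ∧
    {n : ℕ | ∀ u : List Bool, FactorTM u → u.length = n → PalPair u}.Finite := by
  have main : ∀ n, 6 ≤ n → ∃ u : List Bool, FactorTM u ∧ u.length = n ∧ ¬ PalPair u := by
    intro n hn
    obtain ⟨s, hs⟩ := exists_not_palPairAt n hn
    exact ⟨factorAt s n, factorTM_factorAt s n, by simp [factorAt], fun h => hs h.palPairAt⟩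
  refine ⟨main, (Set.finite_lt_nat 6).subset fun n hn => ?_⟩
  by_contra hlt
  obtain ⟨u, hu, hlen, hpp⟩ := main n (not_lt.mp hlt)
  exact hpp (hn u hu hlen)
end

section
/- For each k ≥ 1, the number of distinct factors of the Thue–Morse word t of length 3·2^{2k} that are palindrome pairs is at least 3·2^{2k+1}. -/
/-- The `i`-th letter of the periodic word `μ^j((c c̄ c)^ω)`. -/
def periodicLetter (c : Bool) : ℕ → ℕ → Bool
  | 0, i => xor c (decide (i % 3 = 1))
  | j + 1, i => xor (periodicLetter c j (i / 2)) (decide (i % 2 = 1))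

/-- The factor of length `3 * 2 ^ j` at position `a` of the periodic word `μ^j((c c̄ c)^ω)`. -/
def periodWindow (j : ℕ) (c : Bool) (a : ℕ) : List Bool :=
  (List.range' a (3 * 2 ^ j)).map (periodicLetter c j)

theorem periodicLetter_add_period (c : Bool) (j i q : ℕ) :
    periodicLetter c j (i + q * (3 * 2 ^ j)) = periodicLetter c j i := by
  induction j generalizing i with
  | zero => simp only [periodicLetter]; congr 2; apply propext; omega
  | succ j ih =>
    have h : q * (3 * 2 ^ (j + 1)) = 2 * (q * (3 * 2 ^ j)) := by ring
    have h1 : (i + 2 * (q * (3 * 2 ^ j))) / 2 = i / 2 + q * (3 * 2 ^ j) := by omega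
    have h2 : (i + 2 * (q * (3 * 2 ^ j))) % 2 = i % 2 := by omega
    simp only [periodicLetter, h, h1, h2, ih]

theorem periodicLetter_reflect (c : Bool) (j i i' q : ℕ) (h : i + i' + 1 = q * (3 * 2 ^ j)) :
    periodicLetter c j i' = xor (periodicLetter c j i) (decide (j % 2 = 1)) := by
  induction j generalizing i i' with
  | zero =>
    have h3 : i' % 3 = 1 ↔ i % 3 = 1 := by omega
    simp [periodicLetter, h3]
  | succ j ih =>
    have h' : q * (3 * 2 ^ (j + 1)) = 2 * (q * (3 * 2 ^ j)) := by ring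
    rw [h'] at h
    have h2 : i' % 2 = 1 ↔ ¬ i % 2 = 1 := by omega
    have h3 : (j + 1) % 2 = 1 ↔ ¬ j % 2 = 1 := by omega
    simp only [periodicLetter, ih (i / 2) (i' / 2) (by omega), h2, h3, decide_not]
    generalize periodicLetter c j (i / 2) = x
    generalize decide (i % 2 = 1) = y
    generalize decide (j % 2 = 1) = z
    revert x y z
    decide

theorem periodicLetter_not_eventually_constant (c : Bool) (j b : ℕ)
    (h : ∀ m, periodicLetter c j (b + m + 1) = periodicLetter c j (b + m)) : False := by
  cases j with
  | zero =>
    have h1 := h (2 * b)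
    have h2 : (b + 2 * b) % 3 = 0 := by omega
    have h3 : (b + 2 * b + 1) % 3 = 1 := by omega
    simp [periodicLetter, h2, h3] at h1
  | succ j =>
    have h1 := h b
    have h2 : (b + b) / 2 = b := by omega
    have h3 : (b + b + 1) / 2 = b := by omega
    have h4 : (b + b) % 2 = 0 := by omega
    have h5 : (b + b + 1) % 2 = 1 := by omega
    simp [periodicLetter, h2, h3, h4, h5] at h1

theorem periodicLetter_parity_mismatch (c d : Bool) (j a b : ℕ)
    (h : ∀ m, periodicLetter c (j + 1) (a + m) = periodicLetter d (j + 1) (b + m))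
    (ha : a % 2 = 0) (hb : b % 2 = 1) : False := by
  refine periodicLetter_not_eventually_constant d j (b / 2) fun m => ?_
  have e := h (2 * m)
  have o := h (2 * m + 1)
  have a1 : (a + 2 * m) / 2 = a / 2 + m := by omega
  have a2 : (a + (2 * m + 1)) / 2 = a / 2 + m := by omega
  have b1 : (b + 2 * m) / 2 = b / 2 + m := by omega
  have b2 : (b + (2 * m + 1)) / 2 = b / 2 + m + 1 := by omega
  have a3 : (a + 2 * m) % 2 = 0 := by omega
  have a4 : (a + (2 * m + 1)) % 2 = 1 := by omega
  have b3 : (b + 2 * m) % 2 = 1 := by omega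
  have b4 : (b + (2 * m + 1)) % 2 = 0 := by omega
  simp only [periodicLetter, a1, a2, b1, b2, a3, a4, b3, b4] at e o
  simp at e o
  exact Bool.not_inj (o.symm.trans e)

theorem periodicLetter_shift_injective (c d : Bool) (j a b : ℕ)
    (h : ∀ m, periodicLetter c j (a + m) = periodicLetter d j (b + m))
    (ha : a < 3 * 2 ^ j) (hb : b < 3 * 2 ^ j) : c = d ∧ a = b := by
  induction j generalizing a b with
  | zero =>
    have h0 := h 0
    have h1 := h 1
    have h2 := h 2
    norm_num at ha hb
    revert h0 h1 h2
    interval_cases a <;> interval_cases b <;> revert c d <;> simp [periodicLetter]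
  | succ j ih =>
    rcases Nat.mod_two_eq_zero_or_one a with pa | pa <;>
      rcases Nat.mod_two_eq_zero_or_one b with pb | pb
    case inl.inr => exact (periodicLetter_parity_mismatch c d j a b h pa pb).elim
    case inr.inl =>
      exact (periodicLetter_parity_mismatch d c j b a (fun m => (h m).symm) pb pa).elim
    all_goals
      rw [pow_succ] at ha hb
      have key := ih (a / 2) (b / 2) (fun m => by
        have e := h (2 * m)
        have a1 : (a + 2 * m) / 2 = a / 2 + m := by omega
        have b1 : (b + 2 * m) / 2 = b / 2 + m := by omega
        have a2 : (a + 2 * m) % 2 = a % 2 := by omega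
        have b2 : (b + 2 * m) % 2 = b % 2 := by omega
        simpa [periodicLetter, a1, b1, a2, b2, pa, pb] using e) (by omega) (by omega)
      exact ⟨key.1, by omega⟩

theorem periodWindow_injective (j : ℕ) (c d : Bool) (a b : ℕ) (ha : a < 3 * 2 ^ j)
    (hb : b < 3 * 2 ^ j) (h : periodWindow j c a = periodWindow j d b) : c = d ∧ a = b := by
  refine periodicLetter_shift_injective c d j a b (fun m => ?_) ha hb
  have hr : m % (3 * 2 ^ j) < 3 * 2 ^ j := Nat.mod_lt _ (by positivity)
  have hm := congrArg (fun l : List Bool => l[m % (3 * 2 ^ j)]?) h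
  simp only [periodWindow, List.getElem?_map, List.getElem?_range' hr, one_mul,
    Option.map_some, Option.some.injEq] at hm
  have hq : m % (3 * 2 ^ j) + m / (3 * 2 ^ j) * (3 * 2 ^ j) = m := Nat.mod_add_div' _ _
  calc periodicLetter c j (a + m)
      = periodicLetter c j (a + m % (3 * 2 ^ j) + m / (3 * 2 ^ j) * (3 * 2 ^ j)) := by
        rw [add_assoc, hq]
    _ = periodicLetter d j (b + m % (3 * 2 ^ j) + m / (3 * 2 ^ j) * (3 * 2 ^ j)) := by
        rw [periodicLetter_add_period, periodicLetter_add_period, hm]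
    _ = periodicLetter d j (b + m) := by rw [add_assoc, hq]

theorem mu_append (v w : List Bool) : mu (v ++ w) = mu v ++ mu w := by simp [mu]

theorem List.IsInfix.mu {v w : List Bool} (h : v <:+: w) : _root_.mu v <:+: _root_.mu w := by
  obtain ⟨s, t, rfl⟩ := h
  exact ⟨_root_.mu s, _root_.mu t, by simp only [mu_append]⟩

theorem FactorTM.of_infix {v w : List Bool} (hw : FactorTM w) (h : v <:+: w) : FactorTM v := by
  obtain ⟨k, hk⟩ := hw
  exact ⟨k, h.trans hk⟩

theorem FactorTM.mu {w : List Bool} (hw : FactorTM w) : FactorTM (_root_.mu w) := by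
  obtain ⟨k, hk⟩ := hw
  exact ⟨k + 1, by rw [Function.iterate_succ_apply']; exact hk.mu⟩

theorem mu_map_periodicLetter (c : Bool) (j n : ℕ) :
    mu ((List.range n).map (periodicLetter c j)) =
      (List.range (2 * n)).map (periodicLetter c (j + 1)) := by
  induction n with
  | zero => rfl
  | succ n ih =>
    have h1 : (2 * n + 1) / 2 = n := by omega
    have h2 : (2 * n + 1) % 2 = 1 := by omega
    rw [show 2 * (n + 1) = 2 * n + 1 + 1 by ring]
    simp only [List.range_succ, List.map_append, mu_append, ih, List.append_assoc]
    congr 1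
    simp only [mu, List.map_cons, List.map_nil, periodicLetter, h1, h2]
    cases h : periodicLetter c j n <;> simp [h]

theorem factorTM_periodicLetter_square (c : Bool) (j : ℕ) :
    FactorTM ((List.range (6 * 2 ^ j)).map (periodicLetter c j)) := by
  induction j with
  | zero => exact ⟨5, by revert c; decide⟩
  | succ j ih =>
    rw [show 6 * 2 ^ (j + 1) = 2 * (6 * 2 ^ j) by ring, ← mu_map_periodicLetter]
    exact ih.mu

theorem factorTM_periodWindow (j : ℕ) (c : Bool) (a : ℕ) (ha : a ≤ 3 * 2 ^ j) :
    FactorTM (periodWindow j c a) := by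
  refine (factorTM_periodicLetter_square c j).of_infix (List.IsInfix.map _ ?_)
  refine ⟨List.range' 0 a, List.range' (a + 3 * 2 ^ j) (3 * 2 ^ j - a), ?_⟩
  have h1 := List.range'_append_1 (s := 0) (m := a) (n := 3 * 2 ^ j)
  have h2 := List.range'_append_1 (s := 0) (m := a + 3 * 2 ^ j) (n := 3 * 2 ^ j - a)
  rw [Nat.zero_add] at h1 h2
  rw [h1, h2, List.range_eq_range']
  congr 1
  omega

theorem palindrome_map_range' {α : Type*} (f : ℕ → α) (s l : ℕ)
    (h : ∀ i i', i + i' + 1 = 2 * s + l → f i' = f i) :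
    ((List.range' s l).map f).Palindrome := by
  refine List.Palindrome.of_reverse_eq (List.ext_getElem (by simp) fun i h1 h2 => ?_)
  simp only [List.length_map, List.length_range'] at h2
  simp only [List.getElem_reverse, List.getElem_map, List.getElem_range', List.length_map,
    List.length_range', one_mul]
  exact h _ _ (by omega)

theorem palPair_periodWindow (j : ℕ) (hj : j % 2 = 0) (c : Bool) (a : ℕ) (ha : a ≤ 3 * 2 ^ j) :
    PalPair (periodWindow j c a) := by
  have hsymm : ∀ q i i', i + i' + 1 = q * (3 * 2 ^ j) →
      periodicLetter c j i' = periodicLetter c j i := fun q i i' h => by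
    simpa [hj] using periodicLetter_reflect c j i i' q h
  have split : ∀ l l' q q', l + l' = 3 * 2 ^ j → 2 * a + l = q * (3 * 2 ^ j) →
      2 * (a + l) + l' = q' * (3 * 2 ^ j) → PalPair (periodWindow j c a) :=
    fun l l' q q' hl hq hq' =>
      ⟨_, _, palindrome_map_range' _ a l fun i i' h => hsymm q i i' (h.trans hq),
        palindrome_map_range' _ (a + l) l' fun i i' h => hsymm q' i i' (h.trans hq'), by
        rw [← List.map_append, List.range'_append_1, hl, periodWindow]⟩
  rcases le_total (2 * a) (3 * 2 ^ j) with h | h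
  · exact split (3 * 2 ^ j - 2 * a) (2 * a) 1 2 (by omega) (by omega) (by omega)
  · exact split (2 * (3 * 2 ^ j) - 2 * a) (2 * a - 3 * 2 ^ j) 2 3 (by omega) (by omega) (by omega)

/-- For each `k ≥ 1` there are at least `3 * 2^(2k+1)` factors of the
Thue–Morse word of length `3 * 2^(2k)` that are palindrome pairs. -/
theorem thueMorse_many_palPair_factors (k : ℕ) (hk : 1 ≤ k) :
    3 * 2 ^ (2 * k + 1) ≤
      {u : List Bool | FactorTM u ∧ u.length = 3 * 2 ^ (2 * k) ∧ PalPair u}.ncard := by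
  let s : Finset (Bool × ℕ) := Finset.univ ×ˢ Finset.range (3 * 2 ^ (2 * k))
  let g : Bool × ℕ → List Bool := fun p => periodWindow (2 * k) p.1 p.2
  have hg : Set.InjOn g s := by
    rintro ⟨c, a⟩ h1 ⟨d, b⟩ h2 h
    simp only [s, Finset.coe_product, Set.mem_prod, Finset.mem_coe, Finset.mem_range] at h1 h2
    obtain ⟨rfl, rfl⟩ := periodWindow_injective _ _ _ _ _ h1.2 h2.2 h
    rfl
  have hcard : (g '' s).ncard = 3 * 2 ^ (2 * k + 1) := by
    rw [hg.ncard_image, Set.ncard_coe_finset]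
    simp only [s, Finset.card_product, Finset.card_univ, Fintype.card_bool, Finset.card_range]
    ring
  rw [← hcard]
  refine Set.ncard_le_ncard ?_
    ((List.finite_length_eq Bool (3 * 2 ^ (2 * k))).subset fun u hu => hu.2.1)
  rintro _ ⟨⟨c, a⟩, h, rfl⟩
  simp only [s, Finset.coe_product, Set.mem_prod, Finset.mem_coe, Finset.mem_range] at h
  exact ⟨factorTM_periodWindow _ _ _ h.2.le, by simp [g, periodWindow],
    palPair_periodWindow _ (by omega) _ _ h.2.le⟩
end

section
/- Every minimal non palindrome pair over {0,1} that has an internal maximum block has at most five blocks. -/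
/-- `u` is a proper factor of `w`: a factor (contiguous subword) other than
`w` itself. -/
def ProperFactor (u w : List Bool) : Prop :=
  u <:+: w ∧ u ≠ w

/-- A *minimal non palindrome pair*: a word that is not a palindrome pair but
all of whose proper factors are palindrome pairs. -/
def MNPP (w : List Bool) : Prop :=
  ¬ PalPair w ∧ ∀ u, ProperFactor u w → PalPair u

/-- `IsBlock w c m` says that `w` has a block (maximal run) of the letter `c`
of length `m`: an occurrence of `c^m` that cannot be extended on either side. -/
def IsBlock (w : List Bool) (c : Bool) (m : ℕ) : Prop :=
  0 < m ∧ ∃ p s : List Bool, w = p ++ List.replicate m c ++ s ∧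
    p.getLast? ≠ some c ∧ s.head? ≠ some c

/-- `w` has an *internal maximum block*: a block that is neither the first nor
last block of `w` (so it is flanked on both sides by the other letter) and
whose length is at least that of every block of `w`. -/
def HasInternalMaxBlock (w : List Bool) : Prop :=
  ∃ (c : Bool) (m : ℕ) (u v : List Bool), 0 < m ∧
    w = u ++ List.replicate m c ++ v ∧
    u.getLast? = some (!c) ∧ v.head? = some (!c) ∧
    ∀ c' m', IsBlock w c' m' → m' ≤ m

theorem PalPair.reverse {w : List Bool} (h : PalPair w) : PalPair w.reverse := by
  obtain ⟨p, q, hp, hq, rfl⟩ := h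
  exact ⟨q, p, hq, hp, by simp [hp.reverse_eq, hq.reverse_eq]⟩

/-- A palindrome pair is cut at some position `k` so that the letters on either side of the cut
are symmetric. -/
theorem PalPair.exists_cut {w : List Bool} (h : PalPair w) :
    ∃ k ≤ w.length, (∀ i < k, w[i]? = w[k - 1 - i]?) ∧
      ∀ i < w.length - k, w[k + i]? = w[w.length - 1 - i]? := by
  obtain ⟨p, q, hp, hq, rfl⟩ := h
  refine ⟨p.length, by simp, fun i hi => ?_, fun i hi => ?_⟩
  · rw [List.getElem?_append_left hi, List.getElem?_append_left (by omega),
      ← List.getElem?_reverse hi, hp.reverse_eq]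
  · have hi' : i < q.length := by simpa using hi
    rw [List.getElem?_append_right (by omega), List.getElem?_append_right (by simp; omega),
      show p.length + i - p.length = i by omega,
      show (p ++ q).length - 1 - i - p.length = q.length - 1 - i by simp; omega,
      ← List.getElem?_reverse hi', hq.reverse_eq]

/-- `w` is a concatenation of at most five runs of alternating letters. -/
def FewBlocks (w : List Bool) : Prop :=
  ∃ l : List (Bool × ℕ),
    (l.map (fun p => List.replicate p.2 p.1)).flatten = w ∧
    l.IsChain (fun p q => p.1 ≠ q.1) ∧
    (∀ p ∈ l, 0 < p.2) ∧
    l.length ≤ 5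

/-- Families of words with at most five blocks that are not palindrome pairs. -/
inductive Forbidden : List Bool → Prop
  | twoLong (c d : Bool) (a b : ℕ) (hcd : c ≠ d) (ha : 2 ≤ a) (hb : 2 ≤ b) :
      Forbidden (d :: (List.replicate a c ++ (List.replicate b d ++ [c])))
  | longLeft (c d : Bool) (b : ℕ) (hcd : c ≠ d) (hb : 2 ≤ b) :
      Forbidden (d :: d :: (List.replicate b c ++ [d, c]))
  | longRight (c d : Bool) (b : ℕ) (hcd : c ≠ d) (hb : 2 ≤ b) :
      Forbidden (c :: d :: (List.replicate b c ++ [d, d]))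
  | unequal (c d : Bool) (a b : ℕ) (hcd : c ≠ d) (ha : 1 ≤ a) (hb : 1 ≤ b) (hab : a ≠ b) :
      Forbidden (d :: (List.replicate a c ++ d :: (List.replicate b c ++ [d])))

theorem Forbidden.reverse {w : List Bool} (h : Forbidden w) : Forbidden w.reverse := by
  cases h with
  | twoLong c d a b hcd ha hb => simpa using twoLong d c b a hcd.symm hb ha
  | longLeft c d b hcd hb => simpa using longRight c d b hcd hb
  | longRight c d b hcd hb => simpa using longLeft c d b hcd hb
  | unequal c d a b hcd ha hb hab => simpa using unequal c d b a hcd hb ha hab.symm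

theorem Forbidden.fewBlocks {w : List Bool} (h : Forbidden w) : FewBlocks w := by
  cases h with
  | twoLong c d a b hcd ha hb =>
    refine ⟨[(d, 1), (c, a), (d, b), (c, 1)], by simp, by simp [hcd, hcd.symm], ?_, by simp⟩
    simp; omega
  | longLeft c d b hcd hb =>
    refine ⟨[(d, 2), (c, b), (d, 1), (c, 1)], by simp [List.replicate_succ],
      by simp [hcd, hcd.symm], ?_, by simp⟩
    simp; omega
  | longRight c d b hcd hb =>
    refine ⟨[(c, 1), (d, 1), (c, b), (d, 2)], by simp [List.replicate_succ],
      by simp [hcd, hcd.symm], ?_, by simp⟩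
    simp; omega
  | unequal c d a b hcd ha hb hab =>
    refine ⟨[(d, 1), (c, a), (d, 1), (c, b), (d, 1)], by simp,
      by simp [hcd, hcd.symm], ?_, by simp⟩
    simp; omega

theorem not_palPair_twoLong {c d : Bool} {a b : ℕ} (hcd : c ≠ d) (ha : 2 ≤ a) (hb : 2 ≤ b) :
    ¬ PalPair (d :: (List.replicate a c ++ (List.replicate b d ++ [c]))) := by
  intro h
  obtain ⟨k, hk, hp, hq⟩ := h.exists_cut
  have p0 := hp 0
  have p1 := hp 1
  have q0 := hq 0
  have q1 := hq 1
  clear hp hq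
  simp only [List.length_cons, List.length_append, List.length_replicate, List.length_nil,
    List.getElem?_cons, List.getElem?_append, List.getElem?_replicate] at *
  grind (splits := 30)

theorem not_palPair_longLeft {c d : Bool} {b : ℕ} (hcd : c ≠ d) (hb : 2 ≤ b) :
    ¬ PalPair (d :: d :: (List.replicate b c ++ [d, c])) := by
  intro h
  obtain ⟨k, hk, hp, hq⟩ := h.exists_cut
  have p0 := hp 0
  have p1 := hp 1
  have q0 := hq 0
  have q1 := hq 1
  clear hp hq
  simp only [List.length_cons, List.length_append, List.length_replicate, List.length_nil,
    List.getElem?_cons, List.getElem?_append, List.getElem?_replicate] at *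
  grind (splits := 30)

theorem not_palPair_unequal {c d : Bool} {a b : ℕ} (hcd : c ≠ d) (ha : 1 ≤ a) (hb : 1 ≤ b)
    (hab : a ≠ b) :
    ¬ PalPair (d :: (List.replicate a c ++ d :: (List.replicate b c ++ [d]))) := by
  intro h
  obtain ⟨k, hk, hp, hq⟩ := h.exists_cut
  have p0 := hp 0
  have p1 := hp (a + 1)
  have q0 := hq 0
  have q1 := hq (a + 1)
  clear hp hq
  simp only [List.length_cons, List.length_append, List.length_replicate, List.length_nil,
    List.getElem?_cons, List.getElem?_append, List.getElem?_replicate] at *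
  grind (splits := 30)

theorem Forbidden.not_palPair {w : List Bool} (h : Forbidden w) : ¬ PalPair w := by
  cases h with
  | twoLong c d a b hcd ha hb => exact not_palPair_twoLong hcd ha hb
  | longLeft c d b hcd hb => exact not_palPair_longLeft hcd hb
  | longRight c d b hcd hb =>
    intro h
    exact not_palPair_longLeft hcd hb (by simpa using h.reverse)
  | unequal c d a b hcd ha hb hab => exact not_palPair_unequal hcd ha hb hab

/-- Split off the leading run of the letter `d`. -/
theorem exists_eq_replicate_append (d : Bool) (l : List Bool) :
    ∃ n s, l = List.replicate n d ++ s ∧ s.head? ≠ some d := by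
  induction l with
  | nil => exact ⟨0, [], by simp⟩
  | cons x l ih =>
    obtain ⟨n, s, rfl, hs⟩ := ih
    by_cases hx : x = d
    · exact ⟨n + 1, s, by simp [List.replicate_succ, hx], hs⟩
    · exact ⟨0, x :: (List.replicate n d ++ s), by simp, by simpa using hx⟩

theorem replicate_append_cons_self (n : ℕ) (d : Bool) (l : List Bool) :
    List.replicate n d ++ d :: l = d :: (List.replicate n d ++ l) := by
  induction n with
  | zero => simp
  | succ n ih => simp [List.replicate_succ, ih]

theorem exists_isBlock_of_pair_infix {d : Bool} {w : List Bool} (h : [d, d] <:+: w) :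
    ∃ n, 2 ≤ n ∧ IsBlock w d n := by
  obtain ⟨p, s, rfl⟩ := h
  obtain ⟨n, s, rfl, hs⟩ := exists_eq_replicate_append d s
  obtain ⟨k, r, hr, hr'⟩ := exists_eq_replicate_append d p.reverse
  refine ⟨k + 2 + n, by omega, by omega, r.reverse, s, ?_, by simpa using hr', hs⟩
  rw [List.reverse_eq_iff.1 hr]
  simp [List.replicate_add, List.replicate_succ, replicate_append_cons_self,
    -List.replicate_append_replicate]

/-- The word `d (c^m d)^n`. -/
def comb (c d : Bool) (m : ℕ) : ℕ → List Bool
  | 0 => [d]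
  | n + 1 => d :: (List.replicate m c ++ comb c d m n)

theorem comb_append_comb (c d : Bool) (m k l : ℕ) :
    comb c d m k ++ (List.replicate m c ++ comb c d m l) = comb c d m (k + l + 1) := by
  induction k with
  | zero => simp [comb]
  | succ k ih => rw [show k + 1 + l + 1 = (k + l + 1) + 1 by omega]; simp [comb, ih]

theorem reverse_comb (c d : Bool) (m n : ℕ) : (comb c d m n).reverse = comb c d m n := by
  induction n with
  | zero => simp [comb]
  | succ n ih => simpa [comb, ih] using comb_append_comb c d m n 0

theorem palPair_replicate_append_replicate (c : Bool) {w : List Bool} (hw : w.reverse = w)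
    (i j : ℕ) : PalPair (List.replicate i c ++ (w ++ List.replicate j c)) := by
  wlog hij : i ≤ j generalizing i j
  · simpa [hw] using (this j i (by omega)).reverse
  obtain ⟨t, rfl⟩ := Nat.exists_eq_add_of_le hij
  refine ⟨List.replicate i c ++ (w ++ List.replicate i c), List.replicate t c,
    List.Palindrome.of_reverse_eq (by simp [hw]),
    List.Palindrome.of_reverse_eq (by simp), by simp⟩

/-- `w` has no forbidden factor and, if `m = 1`, no two consecutive letters `d`. -/
def Tame (d : Bool) (m : ℕ) (w : List Bool) : Prop :=
  (∀ x, x <:+: w → ¬ Forbidden x) ∧ (m = 1 → ¬ [d, d] <:+: w)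

theorem Tame.mono {d : Bool} {m : ℕ} {u w : List Bool} (h : Tame d m w) (hu : u <:+: w) :
    Tame d m u :=
  ⟨fun x hx => h.1 x (hx.trans hu), fun hm hx => h.2 hm (hx.trans hu)⟩

theorem Tame.reverse {d : Bool} {m : ℕ} {w : List Bool} (h : Tame d m w) :
    Tame d m w.reverse := by
  refine ⟨fun x hx hf => h.1 x.reverse ?_ hf.reverse, fun hm hx => h.2 hm ?_⟩
  · rwa [← List.reverse_infix, List.reverse_reverse]
  · simpa using List.reverse_infix.2 hx

theorem head?_ne_cases {c d : Bool} (hcd : c ≠ d) {s : List Bool} (hs : s.head? ≠ some c) :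
    s = [] ∨ ∃ t, s = d :: t := by
  cases s with
  | nil => exact Or.inl rfl
  | cons x t =>
    refine Or.inr ⟨t, ?_⟩
    cases x <;> cases c <;> cases d <;> simp_all

/-- The possible shapes of what follows an occurrence of `d c^m` in a tame word. -/
theorem Tame.right_form {c d : Bool} (hcd : c ≠ d) {m : ℕ} (hm : 1 ≤ m) (v : List Bool)
    (h : Tame d m (d :: (List.replicate m c ++ d :: v))) :
    (∃ b, d :: v = List.replicate (b + 2) d) ∨
      ∃ k j, d :: v = comb c d m k ++ List.replicate j c := by
  obtain ⟨t, s, rfl, hs⟩ := exists_eq_replicate_append d v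
  obtain rfl | ⟨s, rfl⟩ := head?_ne_cases hcd.symm hs
  · cases t with
    | zero => exact Or.inr ⟨0, 0, by simp [comb]⟩
    | succ t => exact Or.inl ⟨t, by simp [List.replicate_succ]⟩
  cases t with
  | succ t =>
    exfalso
    obtain hm1 | hm2 : m = 1 ∨ 2 ≤ m := by omega
    · exact h.2 hm1 ⟨d :: List.replicate m c, List.replicate t d ++ c :: s,
        by simp [List.replicate_succ]⟩
    · exact h.1 _ ⟨[], s, by simp [List.replicate_succ]⟩
        (Forbidden.twoLong c d m (t + 2) hcd hm2 (by omega))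
  | zero =>
    obtain ⟨j, r, rfl, hr⟩ := exists_eq_replicate_append c s
    obtain rfl | ⟨r, rfl⟩ := head?_ne_cases hcd hr
    · exact Or.inr ⟨0, j + 1, by simp [comb, List.replicate_succ]⟩
    have hj : m = j + 1 := by
      by_contra hne
      exact h.1 _ ⟨[], r, by simp [List.replicate_succ]⟩
        (Forbidden.unequal c d m (j + 1) hcd hm (by omega) hne)
    have h' : Tame d m (d :: (List.replicate m c ++ d :: r)) :=
      h.mono ⟨d :: List.replicate m c, [], by simp [hj, List.replicate_succ]⟩
    obtain ⟨b, hb⟩ | ⟨k, i, hk⟩ := Tame.right_form hcd hm r h'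
    · exfalso
      rw [hb] at h
      obtain hm1 | hm2 : m = 1 ∨ 2 ≤ m := by omega
      · exact h.2 hm1 ⟨d :: (List.replicate m c ++ d :: c :: List.replicate j c),
          List.replicate b d, by simp [List.replicate_succ]⟩
      · refine h.1 _ ⟨d :: List.replicate j c, List.replicate b d, ?_⟩
          (Forbidden.longRight c d m hcd hm2)
        subst hj
        simp [List.replicate_succ, replicate_append_cons_self]
    · refine Or.inr ⟨k + 1, i, ?_⟩
      simp [hk, comb, hj, List.replicate_succ]
termination_by v.length
decreasing_by subst_vars; simp; omega

theorem not_long_comb {c d : Bool} (hcd : c ≠ d) {m : ℕ} (hm : 1 ≤ m) {a k j : ℕ}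
    (h : Tame d m (List.replicate (a + 2) d ++
      (List.replicate m c ++ (comb c d m k ++ List.replicate j c)))) :
    k = 0 ∧ j = 0 := by
  by_contra hkj
  obtain ⟨s, hs⟩ : ∃ s, comb c d m k ++ List.replicate j c = d :: c :: s := by
    obtain ⟨m, rfl⟩ := Nat.exists_eq_add_of_le' hm
    cases k with
    | succ k => exact ⟨_, by simp [comb, List.replicate_succ]; rfl⟩
    | zero =>
      obtain ⟨j, rfl⟩ : ∃ i, j = i + 1 := ⟨j - 1, by omega⟩
      exact ⟨List.replicate j c, by simp [comb, List.replicate_succ]⟩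
  rw [hs] at h
  obtain hm1 | hm2 : m = 1 ∨ 2 ≤ m := by omega
  · exact h.2 hm1 ⟨[], List.replicate a d ++ (List.replicate m c ++ d :: c :: s),
      by simp [List.replicate_succ]⟩
  · exact h.1 _ ⟨List.replicate a d, s, by simp [List.replicate_succ, replicate_append_cons_self]⟩
      (Forbidden.longLeft c d m hcd hm2)

/-- A tame word with an internal block of length `m` is a palindrome pair. -/
theorem Tame.palPair {c d : Bool} (hcd : c ≠ d) {m : ℕ} (hm : 1 ≤ m) {u v : List Bool}
    (h : Tame d m ((d :: u).reverse ++ (List.replicate m c ++ d :: v))) :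
    PalPair ((d :: u).reverse ++ (List.replicate m c ++ d :: v)) := by
  have hR := Tame.right_form hcd hm v (h.mono ⟨u.reverse, [], by simp⟩)
  have hL := Tame.right_form hcd hm u (h.reverse.mono ⟨v.reverse, [], by simp⟩)
  have one (i j : ℕ) : PalPair (List.replicate i d ++ (List.replicate m c ++
      List.replicate j d)) :=
    palPair_replicate_append_replicate d (by simp) i j
  obtain ⟨a, ha⟩ | ⟨k, i, hk⟩ := hL <;> obtain ⟨b, hb⟩ | ⟨l, j, hl⟩ := hR
  · rw [ha, hb, List.reverse_replicate]
    exact one _ _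
  · rw [ha, hl, List.reverse_replicate] at h ⊢
    obtain ⟨rfl, rfl⟩ := not_long_comb hcd hm h
    exact one _ 1
  · rw [hk, hb] at h ⊢
    obtain ⟨rfl, rfl⟩ := not_long_comb hcd hm (by simpa using h.reverse)
    exact one 1 _
  · rw [hk, hl]
    simpa [reverse_comb, ← comb_append_comb] using
      palPair_replicate_append_replicate c (reverse_comb c d m (k + l + 1)) i j

/-- A minimal non palindrome pair with an internal maximum block has at most
five blocks: it can be written as a concatenation of at most five runs of
alternating letters. -/
theorem mnpp_at_most_five_blocks (w : List Bool)
    (hw : MNPP w) (hint : HasInternalMaxBlock w) :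
    ∃ l : List (Bool × ℕ),
      (l.map (fun p => List.replicate p.2 p.1)).flatten = w ∧
      l.Chain' (fun p q => p.1 ≠ q.1) ∧
      (∀ p ∈ l, 0 < p.2) ∧
      l.length ≤ 5 := by
  change FewBlocks w
  by_contra hfew
  obtain ⟨c, m, u, v, hm, rfl, hu, hv, hmax⟩ := hint
  obtain ⟨u, rfl⟩ : ∃ t, u = ((!c) :: t).reverse := by
    rw [← List.head?_reverse, List.head?_eq_some_iff] at hu
    obtain ⟨t, ht⟩ := hu
    exact ⟨t, List.reverse_eq_iff.1 ht⟩
  obtain ⟨v, rfl⟩ := List.head?_eq_some_iff.1 hv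
  rw [List.append_assoc] at *
  refine hw.1 (Tame.palPair (by simp) hm ⟨fun x hx hf => ?_, fun hm1 hdd => ?_⟩)
  · by_cases hxw : x = ((!c) :: u).reverse ++ (List.replicate m c ++ (!c) :: v)
    · exact hfew (hxw ▸ hf.fewBlocks)
    · exact hf.not_palPair (hw.2 x ⟨hx, hxw⟩)
  · obtain ⟨n, hn, hb⟩ := exists_isBlock_of_pair_infix hdd
    have := hmax _ _ hb
    omega
end
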